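/- Define the GOE two-level cluster function Υ(x) = sin²(πx)/(π²x²) + (1/2 − ∫₀^x sin(πt)/(πt) dt) · (d/dx)(sin(πx)/(πx)) for x > 0. Then for every real κ > 0, 2∫₀^∞ cos(2πκ x) Υ(x) dx equals 1 − 2κ + κ·log(1+2κ) if κ ≤ 1, and equals −1 + κ·log((2κ+1)/(2κ−1)) if κ ≥ 1. -/

import Mathlib

open MeasureTheory

/-- The GOE two-level cluster function at unit mean level density. -/
noncomputable def clusterGOE (x : ℝ) : ℝ :=
  Real.sin (Real.pi * x)^2 / (Real.pi^2 * x^2) +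
    (1/2 - ∫ t in (0:ℝ)..x, Real.sin (Real.pi * t) / (Real.pi * t)) *
      deriv (fun y : ℝ => Real.sin (Real.pi * y) / (Real.pi * y)) x

open Set Filter Topology

/-- The sine integral `Si`. -/
noncomputable def sineIntegral (y : ℝ) : ℝ := ∫ t in (0:ℝ)..y, Real.sinc t

lemma hasDerivAt_sineIntegral (y : ℝ) : HasDerivAt sineIntegral (Real.sinc y) y :=
  intervalIntegral.integral_hasDerivAt_right (Real.continuous_sinc.intervalIntegrable _ _)
    (Real.continuous_sinc.stronglyMeasurableAtFilter _ _) Real.continuous_sinc.continuousAt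

@[fun_prop]
lemma continuous_sineIntegral : Continuous sineIntegral :=
  continuous_iff_continuousAt.2 fun y => (hasDerivAt_sineIntegral y).continuousAt

@[simp]
lemma sineIntegral_zero : sineIntegral 0 = 0 := by simp [sineIntegral]

lemma sineIntegral_neg (y : ℝ) : sineIntegral (-y) = -sineIntegral y := by
  have h := intervalIntegral.integral_comp_neg (a := 0) (b := y) Real.sinc
  simp only [Real.sinc_neg, neg_zero] at h
  rw [sineIntegral, sineIntegral, h, intervalIntegral.integral_symm]

/-- The integrand of the Laplace representation of the complementary sine integral. -/
noncomputable def sineKernel (y u : ℝ) : ℝ :=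
  Real.exp (-(y * u)) * (Real.cos y + u * Real.sin y) * (1 + u ^ 2)⁻¹

lemma continuous_sineKernel : Continuous (Function.uncurry sineKernel) := by
  have : ∀ p : ℝ × ℝ, 1 + p.2 ^ 2 ≠ 0 := fun p => by positivity
  unfold sineKernel Function.uncurry
  fun_prop (disch := assumption)

lemma abs_sineKernel_le {y u : ℝ} (hy : 0 ≤ y) (hu : 0 < u) :
    |sineKernel y u| ≤ 2 * (1 + u ^ 2)⁻¹ := by
  have hyu : 0 ≤ y * u := by positivity
  have h1 : Real.exp (-(y * u)) * (1 + y * u) ≤ 1 := by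
    rw [Real.exp_neg, inv_mul_le_iff₀ (Real.exp_pos _), mul_one, add_comm]
    exact Real.add_one_le_exp _
  have h2 : |Real.cos y + u * Real.sin y| ≤ 1 + y * u := by
    refine (abs_add_le _ _).trans (add_le_add (Real.abs_cos_le_one y) ?_)
    rw [abs_mul, abs_of_pos hu, mul_comm]
    gcongr
    exact (Real.abs_sin_le_abs).trans_eq (abs_of_nonneg hy)
  rw [sineKernel, abs_mul, abs_mul, Real.abs_exp,
    abs_of_nonneg (a := (1 + u ^ 2)⁻¹) (by positivity)]
  gcongr
  calc _ ≤ Real.exp (-(y * u)) * (1 + y * u) := by gcongr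
    _ ≤ 2 := by linarith

lemma abs_sineKernel_le_exp (y : ℝ) (u : ℝ) :
    |sineKernel y u| ≤ Real.exp (-y * u) := by
  have h : |Real.cos y + u * Real.sin y| ≤ 1 + u ^ 2 := by
    apply abs_le_of_sq_le_sq _ (by positivity)
    have := Real.sin_sq_add_cos_sq y
    nlinarith [sq_nonneg (u * Real.cos y - Real.sin y), sq_nonneg u]
  rw [sineKernel, abs_mul, abs_mul, Real.abs_exp,
    abs_of_nonneg (a := (1 + u ^ 2)⁻¹) (by positivity),
    mul_assoc, neg_mul]
  refine mul_le_of_le_one_right (Real.exp_pos _).le ?_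
  rw [← div_eq_mul_inv, div_le_one (by positivity)]
  exact h

lemma hasDerivAt_sineKernel (y u : ℝ) :
    HasDerivAt (sineKernel · u) (-Real.sin y * Real.exp (-y * u)) y := by
  have h1 : HasDerivAt (fun y : ℝ => Real.exp (-(y * u))) (Real.exp (-(y * u)) * -(1 * u)) y :=
    (((hasDerivAt_id y).mul_const u).neg).exp
  have h2 : HasDerivAt (fun y : ℝ => Real.cos y + u * Real.sin y)
      (-Real.sin y + u * Real.cos y) y :=
    (Real.hasDerivAt_cos y).add ((Real.hasDerivAt_sin y).const_mul u)
  refine ((h1.mul h2).mul_const (1 + u ^ 2)⁻¹).congr_deriv ?_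
  have : 1 + u ^ 2 ≠ 0 := by positivity
  rw [neg_mul]
  field_simp
  ring

lemma integrableOn_two_mul_inv_one_add_sq :
    IntegrableOn (fun u : ℝ => 2 * (1 + u ^ 2)⁻¹) (Ioi 0) :=
  (integrable_inv_one_add_sq.const_mul 2).integrableOn

lemma integrableOn_sineKernel {y : ℝ} (hy : 0 ≤ y) : IntegrableOn (sineKernel y) (Ioi 0) := by
  refine integrableOn_two_mul_inv_one_add_sq.mono'
    (continuous_sineKernel.uncurry_left y).aestronglyMeasurable ?_
  filter_upwards [ae_restrict_mem measurableSet_Ioi] with u hu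
  exact abs_sineKernel_le hy hu

lemma continuousOn_integral_sineKernel :
    ContinuousOn (fun y => ∫ u in Ioi (0:ℝ), sineKernel y u) (Ici 0) := by
  refine continuousOn_of_dominated (bound := fun u : ℝ => 2 * (1 + u ^ 2)⁻¹) ?_ ?_
    integrableOn_two_mul_inv_one_add_sq ?_
  · exact fun y _ => (continuous_sineKernel.uncurry_left y).aestronglyMeasurable
  · intro y hy
    filter_upwards [ae_restrict_mem measurableSet_Ioi] with u hu
    exact abs_sineKernel_le hy hu
  · exact Eventually.of_forall fun u => (continuous_sineKernel.uncurry_right u).continuousOn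

lemma hasDerivAt_integral_sineKernel {y : ℝ} (hy : 0 < y) :
    HasDerivAt (fun y => ∫ u in Ioi (0:ℝ), sineKernel y u) (-Real.sinc y) y := by
  have h := (hasDerivAt_integral_of_dominated_loc_of_deriv_le
    (F := sineKernel) (F' := fun y u => -Real.sin y * Real.exp (-y * u)) (x₀ := y)
    (μ := volume.restrict (Ioi (0:ℝ))) (s := Ioi (y / 2))
    (bound := fun u => Real.exp (-(y / 2) * u))
    (Ioi_mem_nhds (by linarith))
    (Eventually.of_forall fun z => (continuous_sineKernel.uncurry_left z).aestronglyMeasurable)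
    (integrableOn_sineKernel hy.le) (by fun_prop) ?_
    (exp_neg_integrableOn_Ioi 0 (by linarith))
    (Eventually.of_forall fun u z _ => hasDerivAt_sineKernel z u)).2
  · refine h.congr_deriv ?_
    rw [integral_const_mul, integral_exp_mul_Ioi (by linarith), Real.sinc_of_ne_zero hy.ne']
    simp
    field_simp
  · filter_upwards [ae_restrict_mem measurableSet_Ioi] with u hu z hz
    rw [norm_mul, norm_neg, Real.norm_eq_abs, Real.norm_eq_abs, Real.abs_exp]
    refine (mul_le_of_le_one_left (Real.exp_pos _).le (Real.abs_sin_le_one z)).trans ?_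
    have hu : 0 < u := hu
    have hz : y / 2 < z := hz
    gcongr

lemma integral_sineKernel {y : ℝ} (hy : 0 ≤ y) :
    ∫ u in Ioi (0:ℝ), sineKernel y u = Real.pi / 2 - sineIntegral y := by
  have h := intervalIntegral.integral_eq_sub_of_hasDerivAt_of_le hy
    (continuousOn_integral_sineKernel.mono Icc_subset_Ici_self)
    (fun z hz => hasDerivAt_integral_sineKernel hz.1)
    (Real.continuous_sinc.neg.intervalIntegrable _ _)
  have h0 : ∫ u in Ioi (0:ℝ), sineKernel 0 u = Real.pi / 2 := by simp [sineKernel]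
  rw [intervalIntegral.integral_neg, h0] at h
  rw [sineIntegral]
  linarith

/-- The complementary sine integral. -/
noncomputable def sineIntegralCompl (y : ℝ) : ℝ := Real.pi / 2 - sineIntegral y

@[fun_prop]
lemma continuous_sineIntegralCompl : Continuous sineIntegralCompl :=
  continuous_const.sub continuous_sineIntegral

lemma hasDerivAt_sineIntegralCompl (y : ℝ) : HasDerivAt sineIntegralCompl (-Real.sinc y) y :=
  (hasDerivAt_sineIntegral y).const_sub _

lemma abs_sineIntegralCompl_le_inv {y : ℝ} (hy : 0 < y) : |sineIntegralCompl y| ≤ y⁻¹ := by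
  have h : ∫ u in Ioi (0:ℝ), Real.exp (-y * u) = y⁻¹ := by
    rw [integral_exp_mul_Ioi (by linarith)]
    simp
  rw [sineIntegralCompl, ← integral_sineKernel hy.le, ← h]
  exact norm_integral_le_of_norm_le (f := sineKernel y) (exp_neg_integrableOn_Ioi 0 hy)
    (Eventually.of_forall (abs_sineKernel_le_exp y))

lemma abs_sineIntegralCompl_le_pi {y : ℝ} (hy : 0 ≤ y) : |sineIntegralCompl y| ≤ Real.pi := by
  have h : ∫ u in Ioi (0:ℝ), 2 * (1 + u ^ 2)⁻¹ = Real.pi := by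
    rw [integral_const_mul, integral_Ioi_inv_one_add_sq]
    simp
    ring
  rw [sineIntegralCompl, ← integral_sineKernel hy, ← h]
  refine norm_integral_le_of_norm_le (f := sineKernel y) integrableOn_two_mul_inv_one_add_sq ?_
  filter_upwards [ae_restrict_mem measurableSet_Ioi] with u hu
  exact abs_sineKernel_le hy hu

lemma tendsto_sineIntegralCompl : Tendsto sineIntegralCompl atTop (𝓝 0) := by
  refine squeeze_zero_norm' ?_ tendsto_inv_atTop_zero
  filter_upwards [eventually_gt_atTop 0] with y hy
  exact abs_sineIntegralCompl_le_inv hy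

/-- The **Dirichlet integral**. -/
lemma tendsto_sineIntegral : Tendsto sineIntegral atTop (𝓝 (Real.pi / 2)) := by
  simpa [sineIntegralCompl] using tendsto_sineIntegralCompl.const_sub (Real.pi / 2)

lemma tendsto_sineIntegral_const_mul (c : ℝ) :
    Tendsto (fun T => sineIntegral (c * T)) atTop (𝓝 (SignType.sign c * (Real.pi / 2))) := by
  rcases lt_trichotomy c 0 with hc | rfl | hc
  · have h := (tendsto_sineIntegral.comp (tendsto_id.const_mul_atTop (neg_pos.2 hc))).neg
    simpa [hc, Function.comp_def, neg_mul, sineIntegral_neg] using h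
  · simp
  · have h := tendsto_sineIntegral.comp (tendsto_id.const_mul_atTop hc)
    simpa [hc, Function.comp_def] using h

lemma abs_sineIntegral_le (y : ℝ) : |sineIntegral y| ≤ 2 * Real.pi := by
  wlog hy : 0 ≤ y generalizing y
  · simpa [sineIntegral_neg] using this (-y) (by linarith)
  have h := abs_le.1 (abs_sineIntegralCompl_le_pi hy)
  have := Real.pi_pos
  rw [sineIntegralCompl] at h
  rw [abs_le]
  constructor <;> linarith [h.1, h.2]

lemma abs_sinc_le_inv {y : ℝ} (hy : 0 < y) : |Real.sinc y| ≤ y⁻¹ := by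
  rw [Real.sinc_of_ne_zero hy.ne', abs_div, abs_of_pos hy, div_eq_mul_inv]
  exact mul_le_of_le_one_left (by positivity) (Real.abs_sin_le_one y)

lemma abs_sineIntegral_sub_le {ε x y : ℝ} (hε : 0 < ε) (hx : ε ≤ x) (hy : ε ≤ y) :
    |sineIntegral y - sineIntegral x| ≤ ε⁻¹ * |y - x| := by
  refine (convex_Ici ε).norm_image_sub_le_of_norm_hasDerivWithin_le
    (fun z _ => (hasDerivAt_sineIntegral z).hasDerivWithinAt) (fun z hz => ?_) hx hy
  have hz : ε ≤ z := hz
  exact (abs_sinc_le_inv (hε.trans_le hz)).trans (by gcongr)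

/-- The value of `∫ y in 0..T, sin (w * y) * sineIntegralCompl y` for `w ≠ 0`. -/
noncomputable def sineTransform (T w : ℝ) : ℝ :=
  ((1 - Real.cos (w * T)) * sineIntegralCompl T + (sineIntegral T
    - sineIntegral ((1 + w) * T) / 2 - sineIntegral ((1 - w) * T) / 2)) / w

lemma hasDerivAt_sineIntegral_const_mul (c y : ℝ) :
    HasDerivAt (fun y => sineIntegral (c * y)) (c * Real.sinc (c * y)) y := by
  have := (hasDerivAt_sineIntegral (c * y)).comp y ((hasDerivAt_id y).const_mul c)
  refine this.congr_deriv (by ring)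

lemma mul_sinc (c y : ℝ) (hy : y ≠ 0) : c * Real.sinc (c * y) = Real.sin (c * y) / y := by
  rcases eq_or_ne c 0 with rfl | hc
  · simp
  · rw [Real.sinc_of_ne_zero (by positivity)]
    field_simp

lemma integral_sin_mul_sineIntegralCompl {w T : ℝ} (hw : w ≠ 0) (hT : 0 ≤ T) :
    ∫ y in (0:ℝ)..T, Real.sin (w * y) * sineIntegralCompl y = sineTransform T w := by
  have h := intervalIntegral.integral_eq_sub_of_hasDerivAt_of_le (f := fun T => sineTransform T w)
    (f' := fun y => Real.sin (w * y) * sineIntegralCompl y) hT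
    (by unfold sineTransform; fun_prop) ?_
    (Continuous.intervalIntegrable (by fun_prop) _ _)
  · rw [h]
    simp [sineTransform]
  · intro y hy
    have hy0 : y ≠ 0 := hy.1.ne'
    have hc : HasDerivAt (fun y => Real.cos (w * y)) (-Real.sin (w * y) * (w * 1)) y :=
      ((hasDerivAt_id y).const_mul w).cos
    refine ((((hc.const_sub 1).mul (hasDerivAt_sineIntegralCompl y)).add
      (((hasDerivAt_sineIntegral y).sub
        ((hasDerivAt_sineIntegral_const_mul (1 + w) y).div_const 2)).sub
        ((hasDerivAt_sineIntegral_const_mul (1 - w) y).div_const 2))).div_const w).congr_deriv ?_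
    rw [mul_sinc _ _ hy0, mul_sinc _ _ hy0, Real.sinc_of_ne_zero hy0, add_mul 1 w y, sub_mul 1 w y,
      one_mul, Real.sin_add, Real.sin_sub]
    field_simp
    ring

lemma abs_sineTransform_le {w T : ℝ} (hT : 0 < T) :
    |sineTransform T w| ≤ 1 + 8 * Real.pi := by
  have hpi := Real.pi_gt_three
  rcases eq_or_ne w 0 with rfl | hw
  · simp [sineTransform]
    positivity
  have hw' : 0 < |w| := abs_pos.2 hw
  rw [sineTransform, abs_div, div_le_iff₀ hw', add_mul 1 (8 * Real.pi)]
  refine (abs_add_le _ _).trans (add_le_add ?_ ?_)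
  · have h1 : |1 - Real.cos (w * T)| ≤ |w| * T := by
      simpa [abs_mul, abs_of_pos hT] using Real.abs_cos_sub_cos_le 0 (w * T)
    rw [abs_mul]
    calc _ ≤ (|w| * T) * T⁻¹ := by
          gcongr
          exact abs_sineIntegralCompl_le_inv hT
      _ = 1 * |w| := by field_simp
  · rcases le_total |w| (1 / 2) with h | h
    · have hb := abs_le.1 h
      have h1 := abs_sineIntegral_sub_le (ε := T / 2) (x := (1 + w) * T) (y := T)
        (by positivity) (by nlinarith) (by linarith)
      have h2 := abs_sineIntegral_sub_le (ε := T / 2) (x := (1 - w) * T) (y := T)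
        (by positivity) (by nlinarith) (by linarith)
      have e1 : (T / 2)⁻¹ * |T - (1 + w) * T| = 2 * |w| := by
        rw [show T - (1 + w) * T = -(w * T) by ring, abs_neg, abs_mul, abs_of_pos hT]
        field_simp
      have e2 : (T / 2)⁻¹ * |T - (1 - w) * T| = 2 * |w| := by
        rw [show T - (1 - w) * T = w * T by ring, abs_mul, abs_of_pos hT]
        field_simp
      rw [e1, abs_le] at h1
      rw [e2, abs_le] at h2
      rw [abs_le]
      constructor <;> nlinarith
    · have h1 := abs_le.1 (abs_sineIntegral_le T)
      have h2 := abs_le.1 (abs_sineIntegral_le ((1 + w) * T))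
      have h3 := abs_le.1 (abs_sineIntegral_le ((1 - w) * T))
      rw [abs_le]
      constructor <;> nlinarith

lemma tendsto_sineTransform {w : ℝ} (hw : -1 < w) (h1 : w ≠ 1) :
    Tendsto (fun T => sineTransform T w) atTop
      (𝓝 (if 1 < w then Real.pi / 2 * w⁻¹ else 0)) := by
  have hb : Tendsto (fun T => (1 - Real.cos (w * T)) * sineIntegralCompl T) atTop (𝓝 0) := by
    refine bdd_le_mul_tendsto_zero' 2 (Eventually.of_forall fun T => ?_) tendsto_sineIntegralCompl
    rw [abs_le]
    constructor <;> linarith [Real.neg_one_le_cos (w * T), Real.cos_le_one (w * T)]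
  have h := (hb.add ((tendsto_sineIntegral.sub
    ((tendsto_sineIntegral_const_mul (1 + w)).div_const 2)).sub
    ((tendsto_sineIntegral_const_mul (1 - w)).div_const 2))).div_const w
  convert! h using 2
  rw [sign_pos (by linarith : 0 < 1 + w)]
  rcases lt_or_gt_of_ne h1 with h1 | h1
  · rw [sign_pos (by linarith : 0 < 1 - w), if_neg h1.not_gt]
    simp only [SignType.coe_one]
    ring
  · rw [sign_neg (by linarith : 1 - w < 0), if_pos h1]
    simp only [SignType.coe_one, SignType.coe_neg_one]
    ring

lemma integral_sin_mul_compl_mul_sinc {a T : ℝ} (hT : 0 ≤ T) :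
    ∫ y in (0:ℝ)..T, Real.sin (a * y) * sineIntegralCompl y * Real.sinc y =
      (∫ w in (a - 1)..(a + 1), sineTransform T w) / 2 := by
  have key : ∀ y : ℝ, Real.sin (a * y) * sineIntegralCompl y * Real.sinc y =
      (∫ w in (a - 1)..(a + 1), Real.sin (w * y) * sineIntegralCompl y) / 2 := by
    intro y
    rw [intervalIntegral.integral_mul_const]
    rcases eq_or_ne y 0 with rfl | hy
    · simp
    · rw [intervalIntegral.integral_comp_mul_right _ hy, integral_sin, Real.sinc_of_ne_zero hy,
        sub_mul, add_mul, Real.cos_add, Real.cos_sub, smul_eq_mul]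
      field_simp
      ring
  simp_rw [key]
  rw [intervalIntegral.integral_div, intervalIntegral_intervalIntegral_swap]
  · congr 1
    refine intervalIntegral.integral_congr_ae ?_
    filter_upwards [Measure.ae_ne volume (0:ℝ)] with w hw _
    exact integral_sin_mul_sineIntegralCompl hw hT
  · have hc : Continuous (Function.uncurry fun y w : ℝ =>
        Real.sin (w * y) * sineIntegralCompl y) := by
      unfold Function.uncurry
      fun_prop
    exact (hc.continuousOn.integrableOn_compact (isCompact_uIcc.prod isCompact_uIcc)).mono_set
      (prod_mono uIoc_subset_uIcc uIoc_subset_uIcc)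

lemma tendsto_integral_sin_mul_compl_mul_sinc {a : ℝ} (ha : 0 ≤ a) :
    Tendsto (fun T => ∫ y in (0:ℝ)..T, Real.sin (a * y) * sineIntegralCompl y * Real.sinc y) atTop
      (𝓝 ((∫ w in (a - 1)..(a + 1), if 1 < w then Real.pi / 2 * w⁻¹ else 0) / 2)) := by
  have h : Tendsto (fun T => ∫ w in (a - 1)..(a + 1), sineTransform T w) atTop
      (𝓝 (∫ w in (a - 1)..(a + 1), if 1 < w then Real.pi / 2 * w⁻¹ else 0)) := by
    refine intervalIntegral.tendsto_integral_filter_of_dominated_convergence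
      (fun _ => 1 + 8 * Real.pi) ?_ ?_ (intervalIntegrable_const) ?_
    · refine Eventually.of_forall fun T => Measurable.aestronglyMeasurable ?_
      unfold sineTransform
      have := continuous_sineIntegral.measurable
      fun_prop
    · filter_upwards [eventually_gt_atTop 0] with T hT
      exact Eventually.of_forall fun w _ => abs_sineTransform_le hT
    · filter_upwards [Measure.ae_ne volume (1:ℝ)] with w hw hw'
      rw [uIoc_of_le (by linarith)] at hw'
      exact tendsto_sineTransform (by linarith [hw'.1]) hw
  refine (h.div_const 2).congr' ?_
  filter_upwards [eventually_ge_atTop 0] with T hT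
  exact (integral_sin_mul_compl_mul_sinc hT).symm

lemma integral_ite_inv_of_le {a : ℝ} (ha : 0 ≤ a) (ha2 : a ≤ 2) :
    ∫ w in (a - 1)..(a + 1), (if 1 < w then Real.pi / 2 * w⁻¹ else 0) =
      Real.pi / 2 * Real.log (a + 1) := by
  have hi : ∀ b c : ℝ, IntervalIntegrable (fun w : ℝ => if 1 < w then Real.pi / 2 * w⁻¹ else 0)
      volume b c := by
    intro b c
    refine (intervalIntegrable_const (c := Real.pi / 2)).mono_fun
      (Measurable.aestronglyMeasurable ?_) (Eventually.of_forall fun w => ?_)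
    · exact Measurable.ite measurableSet_Ioi (by fun_prop) measurable_const
    · have := Real.pi_pos
      dsimp only
      split_ifs with h
      · rw [norm_mul]
        refine mul_le_of_le_one_right (norm_nonneg _) ?_
        rw [norm_inv, Real.norm_of_nonneg (by linarith)]
        exact inv_le_one_of_one_le₀ h.le
      · rw [norm_zero]
        exact norm_nonneg _
  rw [← intervalIntegral.integral_add_adjacent_intervals (hi _ 1) (hi 1 _)]
  have e1 : ∫ w in (a - 1)..1, (if 1 < w then Real.pi / 2 * w⁻¹ else 0) =
      ∫ w in (a - 1)..1, (0:ℝ) := by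
    refine intervalIntegral.integral_congr fun w hw => ?_
    rw [uIcc_of_le (by linarith)] at hw
    exact if_neg hw.2.not_gt
  have e2 : ∫ w in (1:ℝ)..(a + 1), (if 1 < w then Real.pi / 2 * w⁻¹ else 0) =
      ∫ w in (1:ℝ)..(a + 1), Real.pi / 2 * w⁻¹ := by
    refine intervalIntegral.integral_congr_ae (Eventually.of_forall fun w hw => ?_)
    rw [uIoc_of_le (by linarith)] at hw
    exact if_pos hw.1
  rw [e1, e2, intervalIntegral.integral_const_mul, integral_inv_of_pos one_pos (by linarith)]
  simp

lemma integral_ite_inv_of_ge {a : ℝ} (ha : 2 ≤ a) :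
    ∫ w in (a - 1)..(a + 1), (if 1 < w then Real.pi / 2 * w⁻¹ else 0) =
      Real.pi / 2 * Real.log ((a + 1) / (a - 1)) := by
  have e2 : ∫ w in (a - 1)..(a + 1), (if 1 < w then Real.pi / 2 * w⁻¹ else 0) =
      ∫ w in (a - 1)..(a + 1), Real.pi / 2 * w⁻¹ := by
    refine intervalIntegral.integral_congr_ae (Eventually.of_forall fun w hw => ?_)
    rw [uIoc_of_le (by linarith)] at hw
    exact if_pos (by linarith [hw.1])
  rw [e2, intervalIntegral.integral_const_mul, integral_inv_of_pos (by linarith) (by linarith)]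

/-- A primitive of `fun y => Real.cos (a * y) * Real.sinc y ^ 2` on `(0, ∞)`. -/
noncomputable def cosSincSqPrimitive (a y : ℝ) : ℝ :=
  -(Real.cos (a * y) * Real.sin y * Real.sinc y) - a / 2 * sineIntegral (a * y)
    + (a + 2) / 4 * sineIntegral ((a + 2) * y) + (a - 2) / 4 * sineIntegral ((a - 2) * y)

/-- The derivative of `Real.sinc` away from the origin. -/
lemma hasDerivAt_sinc {y : ℝ} (hy : y ≠ 0) :
    HasDerivAt Real.sinc ((Real.cos y - Real.sinc y) / y) y := by
  have h := (Real.hasDerivAt_sin y).div (hasDerivAt_id y) hy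
  refine (h.congr_of_eventuallyEq ?_).congr_deriv ?_
  · filter_upwards [isOpen_ne.mem_nhds hy] with z hz
    simpa using Real.sinc_of_ne_zero hz
  · rw [Real.sinc_of_ne_zero hy]
    simp
    field_simp

lemma hasDerivAt_cos_const_mul (a y : ℝ) :
    HasDerivAt (fun y => Real.cos (a * y)) (-(a * Real.sin (a * y))) y := by
  refine (((hasDerivAt_id y).const_mul a).cos).congr_deriv ?_
  simp only [id]
  ring

lemma hasDerivAt_cosSincSqPrimitive (a : ℝ) {y : ℝ} (hy : y ≠ 0) :
    HasDerivAt (cosSincSqPrimitive a) (Real.cos (a * y) * Real.sinc y ^ 2) y := by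
  have h := (((((hasDerivAt_cos_const_mul a y).mul (Real.hasDerivAt_sin y)).mul
    (hasDerivAt_sinc hy)).neg.sub ((hasDerivAt_sineIntegral_const_mul a y).const_mul (a / 2))).add
    ((hasDerivAt_sineIntegral_const_mul (a + 2) y).const_mul ((a + 2) / 4))).add
    ((hasDerivAt_sineIntegral_const_mul (a - 2) y).const_mul ((a - 2) / 4))
  refine h.congr_deriv ?_
  rw [Pi.mul_apply, mul_sinc _ _ hy, mul_sinc _ _ hy, mul_sinc _ _ hy, Real.sinc_of_ne_zero hy,
    add_mul a 2 y, sub_mul a 2 y, Real.sin_add, Real.sin_sub, Real.sin_two_mul, Real.cos_two_mul, Real.cos_sq']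
  field_simp
  ring

lemma tendsto_sinc_atTop : Tendsto Real.sinc atTop (𝓝 0) := by
  refine squeeze_zero_norm' ?_ tendsto_inv_atTop_zero
  filter_upwards [eventually_gt_atTop 0] with y hy
  exact abs_sinc_le_inv hy

lemma tendsto_cosSincSqPrimitive {a : ℝ} (ha : 0 < a) :
    Tendsto (cosSincSqPrimitive a) atTop (𝓝 (Real.pi / 2 * max (1 - a / 2) 0)) := by
  have hb : Tendsto (fun y => Real.cos (a * y) * Real.sin y * Real.sinc y) atTop (𝓝 0) := by
    refine bdd_le_mul_tendsto_zero' 1 (Eventually.of_forall fun T => ?_) tendsto_sinc_atTop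
    rw [abs_mul]
    exact mul_le_one₀ (Real.abs_cos_le_one _) (abs_nonneg _) (Real.abs_sin_le_one _)
  have h := ((hb.neg.sub ((tendsto_sineIntegral_const_mul a).const_mul (a / 2))).add
    ((tendsto_sineIntegral_const_mul (a + 2)).const_mul ((a + 2) / 4))).add
    ((tendsto_sineIntegral_const_mul (a - 2)).const_mul ((a - 2) / 4))
  convert! h using 2
  rw [sign_pos ha, sign_pos (by linarith : 0 < a + 2)]
  rcases lt_trichotomy a 2 with h2 | rfl | h2
  · rw [sign_neg (by linarith : a - 2 < 0), max_eq_left (by linarith)]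
    simp
    ring
  · simp
    ring
  · rw [sign_pos (by linarith : 0 < a - 2), max_eq_right (by linarith)]
    simp
    ring

lemma abs_cos_sub_sinc_le {y : ℝ} (hy : 0 < y) (hy1 : y ≤ 1) :
    |Real.cos y - Real.sinc y| ≤ y := by
  have h1 := Real.one_sub_sq_div_two_le_cos (x := y)
  have h2 := Real.sinc_le_one y
  have h3 := Real.cos_le_one y
  have h4 : 1 - y ^ 2 / 4 ≤ Real.sinc y := by
    rw [Real.sinc_of_ne_zero hy.ne', le_div_iff₀ hy]
    nlinarith [Real.sin_gt_sub_cube hy, pow_pos hy 3]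
  rw [abs_le]
  constructor <;> nlinarith

/-- The cluster function at mean level density `1 / π`. -/
noncomputable def scaledClusterGOE (y : ℝ) : ℝ :=
  Real.sinc y ^ 2 + sineIntegralCompl y * ((Real.cos y - Real.sinc y) / y)

lemma abs_scaledClusterGOE_le {y : ℝ} (hy : 0 < y) :
    |scaledClusterGOE y| ≤ 2 * (1 + Real.pi) * (1 + y ^ 2)⁻¹ := by
  have hpi := Real.pi_gt_three
  rw [scaledClusterGOE, ← div_eq_mul_inv, le_div_iff₀ (by positivity)]
  rcases le_total y 1 with h1 | h1
  · have hs : |Real.sinc y ^ 2| ≤ 1 := by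
      rw [abs_pow]
      exact pow_le_one₀ (abs_nonneg _) (Real.abs_sinc_le_one y)
    have hd : |(Real.cos y - Real.sinc y) / y| ≤ 1 := by
      rw [abs_div, abs_of_pos hy, div_le_one hy]
      exact abs_cos_sub_sinc_le hy h1
    have : |Real.sinc y ^ 2 + sineIntegralCompl y * ((Real.cos y - Real.sinc y) / y)| ≤
        1 + Real.pi := by
      refine (abs_add_le _ _).trans (add_le_add hs ?_)
      rw [abs_mul, ← mul_one Real.pi]
      exact mul_le_mul (abs_sineIntegralCompl_le_pi hy.le) hd (abs_nonneg _) (by positivity)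
    calc _ ≤ (1 + Real.pi) * 2 := by
          gcongr
          nlinarith
      _ = _ := mul_comm _ _
  · have hs : |Real.sinc y ^ 2| ≤ (y⁻¹) ^ 2 := by
      rw [abs_pow]
      exact pow_le_pow_left₀ (abs_nonneg _) (abs_sinc_le_inv hy) 2
    have hd : |(Real.cos y - Real.sinc y) / y| ≤ 2 * y⁻¹ := by
      rw [abs_div, abs_of_pos hy, div_eq_mul_inv]
      gcongr
      refine (abs_sub _ _).trans ?_
      linarith [Real.abs_cos_le_one y, Real.abs_sinc_le_one y]
    have : |Real.sinc y ^ 2 + sineIntegralCompl y * ((Real.cos y - Real.sinc y) / y)| ≤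
        3 * (y⁻¹) ^ 2 := by
      refine (abs_add_le _ _).trans ((add_le_add hs ?_).trans_eq
        (by ring : (y⁻¹) ^ 2 + y⁻¹ * (2 * y⁻¹) = _))
      rw [abs_mul]
      exact mul_le_mul (abs_sineIntegralCompl_le_inv hy) hd (abs_nonneg _) (by positivity)
    calc _ ≤ 3 * (y⁻¹) ^ 2 * (1 + y ^ 2) := by gcongr
      _ = 3 * (y⁻¹) ^ 2 + 3 := by field_simp
      _ ≤ 3 * 1 + 3 := by
        gcongr
        exact pow_le_one₀ (by positivity) (inv_le_one_of_one_le₀ h1)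
      _ ≤ _ := by linarith

lemma integrableOn_cos_mul_scaledClusterGOE (a : ℝ) :
    IntegrableOn (fun y => Real.cos (a * y) * scaledClusterGOE y) (Ioi 0) := by
  refine ((integrable_inv_one_add_sq.const_mul (2 * (1 + Real.pi))).integrableOn).mono'
    (Measurable.aestronglyMeasurable ?_) ?_
  · unfold scaledClusterGOE
    have := Real.continuous_sinc.measurable
    have := continuous_sineIntegralCompl.measurable
    fun_prop
  · filter_upwards [ae_restrict_mem measurableSet_Ioi] with y hy
    rw [norm_mul]
    exact (mul_le_of_le_one_left (norm_nonneg _) (Real.abs_cos_le_one _)).trans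
      (abs_scaledClusterGOE_le hy)

lemma integral_cos_mul_scaledClusterGOE {a : ℝ} (ha : 0 < a) :
    ∫ y in Ioi (0:ℝ), Real.cos (a * y) * scaledClusterGOE y =
      Real.pi * max (1 - a / 2) 0 - Real.pi / 2 +
        a / 2 * ∫ w in (a - 1)..(a + 1), if 1 < w then Real.pi / 2 * w⁻¹ else 0 := by
  have hcont : Continuous fun y : ℝ =>
      Real.sin (a * y) * sineIntegralCompl y * Real.sinc y := by fun_prop
  have hI (T : ℝ) := intervalIntegral.integral_hasDerivAt_right
    (hcont.intervalIntegrable 0 T) (hcont.stronglyMeasurableAtFilter _ _) hcont.continuousAt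
  have h0 : Tendsto (fun T => Real.cos (a * T) * (sineIntegralCompl T * Real.sinc T)) atTop
      (𝓝 0) := by
    refine bdd_le_mul_tendsto_zero' 1
      (Eventually.of_forall fun T => Real.abs_cos_le_one _) ?_
    simpa using tendsto_sineIntegralCompl.mul tendsto_sinc_atTop
  simp only [← mul_assoc] at h0
  have h := integral_Ioi_of_hasDerivAt_of_tendsto (a := 0)
    (f := fun T => 2 * cosSincSqPrimitive a T + Real.cos (a * T) * sineIntegralCompl T * Real.sinc T
      + a * ∫ y in (0:ℝ)..T, Real.sin (a * y) * sineIntegralCompl y * Real.sinc y)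
    ?_ ?_ (integrableOn_cos_mul_scaledClusterGOE a)
    ((((tendsto_cosSincSqPrimitive ha).const_mul 2).add h0).add
      ((tendsto_integral_sin_mul_compl_mul_sinc ha.le).const_mul a))
  · rw [h]
    simp [cosSincSqPrimitive, sineIntegralCompl]
    ring
  · have h1 : Continuous fun T => ∫ y in (0:ℝ)..T,
        Real.sin (a * y) * sineIntegralCompl y * Real.sinc y :=
      continuous_iff_continuousAt.2 fun T => (hI T).continuousAt
    refine Continuous.continuousWithinAt ?_
    unfold cosSincSqPrimitive
    fun_prop
  · intro y hy
    have hy : y ≠ 0 := ne_of_gt hy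
    refine ((((hasDerivAt_cosSincSqPrimitive a hy).const_mul 2).add
      (((hasDerivAt_cos_const_mul a y).mul (hasDerivAt_sineIntegralCompl y)).mul
        (hasDerivAt_sinc hy))).add ((hI y).const_mul a)).congr_deriv ?_
    rw [Pi.mul_apply, scaledClusterGOE]
    ring

lemma clusterGOE_eq {x : ℝ} (hx : 0 < x) : clusterGOE x = scaledClusterGOE (Real.pi * x) := by
  have hpi := Real.pi_pos
  have hpx : Real.pi * x ≠ 0 := by positivity
  have h1 : ∫ t in (0:ℝ)..x, Real.sin (Real.pi * t) / (Real.pi * t) =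
      Real.pi⁻¹ * sineIntegral (Real.pi * x) := by
    have : ∫ t in (0:ℝ)..x, Real.sin (Real.pi * t) / (Real.pi * t) =
        ∫ t in (0:ℝ)..x, Real.sinc (Real.pi * t) := by
      refine intervalIntegral.integral_congr_ae (Eventually.of_forall fun t ht => ?_)
      rw [uIoc_of_le hx.le] at ht
      exact (Real.sinc_of_ne_zero (mul_pos hpi ht.1).ne').symm
    rw [this, intervalIntegral.integral_comp_mul_left _ hpi.ne', mul_zero, smul_eq_mul,
      sineIntegral]
  have h2 : deriv (fun y : ℝ => Real.sin (Real.pi * y) / (Real.pi * y)) x =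
      Real.pi * ((Real.cos (Real.pi * x) - Real.sinc (Real.pi * x)) / (Real.pi * x)) := by
    have h := (hasDerivAt_sinc hpx).comp x ((hasDerivAt_id x).const_mul Real.pi)
    refine ((h.congr_of_eventuallyEq ?_).congr_deriv (by ring)).deriv
    filter_upwards [isOpen_ne.mem_nhds hx.ne'] with z hz
    exact (Real.sinc_of_ne_zero (mul_ne_zero hpi.ne' hz)).symm
  rw [clusterGOE, h1, h2, scaledClusterGOE, sineIntegralCompl, Real.sinc_of_ne_zero hpx]
  field_simp

lemma integral_cos_mul_clusterGOE {κ : ℝ} (hκ : 0 < κ) :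
    2 * ∫ x in Ioi (0:ℝ), Real.cos (2 * Real.pi * κ * x) * clusterGOE x =
      2 * max (1 - κ) 0 - 1 + κ * (2 / Real.pi *
        ∫ w in (2 * κ - 1)..(2 * κ + 1), if 1 < w then Real.pi / 2 * w⁻¹ else 0) := by
  have hpi := Real.pi_pos
  have h1 : ∫ x in Ioi (0:ℝ), Real.cos (2 * Real.pi * κ * x) * clusterGOE x =
      ∫ x in Ioi (0:ℝ), (fun y => Real.cos (2 * κ * y) * scaledClusterGOE y) (Real.pi * x) := by
    refine setIntegral_congr_fun measurableSet_Ioi fun x hx => ?_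
    simp only
    rw [clusterGOE_eq hx]
    ring_nf
  rw [h1, integral_comp_mul_left_Ioi (fun y => Real.cos (2 * κ * y) * scaledClusterGOE y) _ hpi,
    mul_zero, smul_eq_mul,
    integral_cos_mul_scaledClusterGOE (by positivity), mul_div_cancel_left₀ _ two_ne_zero]
  field_simp

theorem GOE_form_factor (κ : ℝ) (hκ : 0 < κ) :
    (κ ≤ 1 →
      2 * ∫ x in Set.Ioi (0:ℝ), Real.cos (2 * Real.pi * κ * x) * clusterGOE x =
        1 - 2*κ + κ * Real.log (1 + 2*κ)) ∧
    (1 ≤ κ →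
      2 * ∫ x in Set.Ioi (0:ℝ), Real.cos (2 * Real.pi * κ * x) * clusterGOE x =
        -1 + κ * Real.log ((2*κ + 1) / (2*κ - 1))) := by
  have hpi := Real.pi_pos
  rw [integral_cos_mul_clusterGOE hκ]
  refine ⟨fun h => ?_, fun h => ?_⟩
  · rw [integral_ite_inv_of_le (by positivity) (by linarith), max_eq_left (by linarith),
      add_comm 1 (2 * κ)]
    field_simp
    ring
  · rw [integral_ite_inv_of_ge (by linarith), max_eq_right (by linarith)]
    field_simp
    ring
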